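/- arXiv:1410.4173 — 4 statements merged into one kernel-verified Lean document; each statement's English description precedes it below -/
import Mathlib

section
/- Let X be a geodesic δ-hyperbolic metric space with basepoint x0. There is a constant C depending only on δ such that: if z lies in the shadow S_{x0}(y,R), γ is a geodesic from x0 to y, and p is a nearest point projection of z to γ, then d(y,p) ≤ R + C; and if z does not lie in S_{x0}(y,R) then d(y,p) ≥ R − C. As a consequence, the complement of the shadow S_x(y,R) is contained in the shadow S_y(x, R̃), where R̃ = d(x,y) − R + C' for a constant C' depending only on δ. -/
open Filter Metric Set Topology

noncomputable section

/-- The Gromov product `(x·y)_p = ½(d(p,x) + d(p,y) − d(x,y))`. -/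
def gromovProd {X : Type*} [MetricSpace X] (p x y : X) : ℝ :=
  (dist p x + dist p y - dist x y) / 2

/-- `f` is a unit-speed geodesic segment from `x` to `y`, parametrized on `[0, d(x,y)]`. -/
def IsGeodesicSegment {X : Type*} [MetricSpace X] (f : ℝ → X) (x y : X) : Prop :=
  f 0 = x ∧ f (dist x y) = y ∧
    ∀ s ∈ Set.Icc (0 : ℝ) (dist x y), ∀ t ∈ Set.Icc (0 : ℝ) (dist x y),
      dist (f s) (f t) = |s - t|

/-- The image of a geodesic segment from `x` to `y`. -/
def geodImage {X : Type*} [MetricSpace X] (f : ℝ → X) (x y : X) : Set X :=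
  f '' Set.Icc 0 (dist x y)

/-- A metric space is geodesic if any two points are joined by a geodesic segment. -/
def GeodesicSpace (X : Type*) [MetricSpace X] : Prop :=
  ∀ x y : X, ∃ f : ℝ → X, IsGeodesicSegment f x y

/-- `X` is `δ`-hyperbolic in the sense of slim triangles: every side of every geodesic
triangle is contained in the `δ`-neighbourhood of the union of the other two sides. -/
def SlimTriangles (δ : ℝ) (X : Type*) [MetricSpace X] : Prop :=
  ∀ (x y z : X) (f g h : ℝ → X), IsGeodesicSegment f x y → IsGeodesicSegment g y z →
    IsGeodesicSegment h x z →
      ∀ p ∈ geodImage f x y, Metric.infDist p (geodImage g y z ∪ geodImage h x z) ≤ δ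

/-- The shadow `S_{x0}(x, R) = { y : (x·y)_{x0} ≥ d(x0,x) − R }`. -/
def shadow {X : Type*} [MetricSpace X] (x0 x : X) (R : ℝ) : Set X :=
  {y | dist x0 x - R ≤ gromovProd x0 x y}

/-- A `(Q,c)`-quasigeodesic, parametrized on the set `s ⊆ ℝ`. -/
def IsQuasigeodesicOn {X : Type*} [MetricSpace X] (Q c : ℝ) (f : ℝ → X) (s : Set ℝ) : Prop :=
  ∀ u ∈ s, ∀ v ∈ s,
    (1 / Q) * |u - v| - c ≤ dist (f u) (f v) ∧ dist (f u) (f v) ≤ Q * |u - v| + c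

end

theorem dist_add_dist_of_mem_geodImage {X : Type*} [MetricSpace X] {f : ℝ → X} {x y w : X}
    (hf : IsGeodesicSegment f x y) (hw : w ∈ geodImage f x y) :
    dist x w + dist w y = dist x y := by
  obtain ⟨h0, h1, hd⟩ := hf
  obtain ⟨t, ht, rfl⟩ := hw
  have hxt := hd 0 ⟨le_rfl, dist_nonneg⟩ t ht
  have hty := hd t ht (dist x y) ⟨dist_nonneg, le_rfl⟩
  rw [h0, zero_sub, abs_neg, abs_of_nonneg ht.1] at hxt
  rw [h1, abs_sub_comm, abs_of_nonneg (sub_nonneg.2 ht.2)] at hty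
  rw [hxt, hty]
  ring

/-- In a space with slim triangles, if the initial point `p` of a geodesic segment from `p` to `y`
is a nearest point of the segment to `z`, then passing through `p` is an almost shortest way from
`z` to `y`. -/
theorem dist_add_dist_le_of_nearest_endpoint {X : Type*} [MetricSpace X] {δ : ℝ} (hδ : 0 ≤ δ)
    (hX : GeodesicSpace X) (hs : SlimTriangles δ X) {f : ℝ → X} {p y z : X}
    (hf : IsGeodesicSegment f p y) (hz : ∀ q ∈ geodImage f p y, dist z p ≤ dist z q) :
    dist z p + dist p y ≤ dist z y + (4 * δ + 5) := by
  by_cases hD : dist p y ≤ 2 * δ + 3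
  · have hy := hz y ⟨dist p y, ⟨dist_nonneg, le_rfl⟩, hf.2.1⟩
    linarith
  push Not at hD
  obtain ⟨g, hg⟩ := hX y z
  obtain ⟨h, hh⟩ := hX p z
  have htI : 2 * δ + 3 ∈ Set.Icc 0 (dist p y) := ⟨by linarith, hD.le⟩
  have hq : f (2 * δ + 3) ∈ geodImage f p y := ⟨_, htI, rfl⟩
  have hpq : dist p (f (2 * δ + 3)) = 2 * δ + 3 := by
    have := hf.2.2 0 ⟨le_rfl, dist_nonneg⟩ _ htI
    rwa [hf.1, zero_sub, abs_neg, abs_of_nonneg htI.1] at this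
  generalize f (2 * δ + 3) = q at hq hpq
  have hne : (geodImage g y z ∪ geodImage h p z).Nonempty :=
    ⟨g 0, Or.inl ⟨0, ⟨le_rfl, dist_nonneg⟩, rfl⟩⟩
  obtain ⟨w, hw, hqw⟩ := (Metric.infDist_lt_iff hne).1
    (lt_of_le_of_lt (hs p y z f g h hf hg hh q hq) (lt_add_one δ))
  have hzq := hz q hq
  have hzwq := dist_triangle z w q
  have hpy := dist_add_dist_of_mem_geodImage hf hq
  rw [dist_comm q w] at hqw
  rcases hw with hw | hw
  · have hyz := dist_add_dist_of_mem_geodImage hg hw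
    have hqwy := dist_triangle y w q
    rw [dist_comm w z, dist_comm y z] at hyz
    rw [dist_comm y q] at hqwy
    linarith
  · have hpz := dist_add_dist_of_mem_geodImage hh hw
    have hpwq := dist_triangle p w q
    rw [dist_comm w z, dist_comm p z] at hpz
    linarith

/-- If `p` is a nearest point to `z` on a geodesic segment, then passing through `p` is an almost
shortest way from `z` to either endpoint of the segment. -/
theorem dist_add_dist_le_of_nearest_point {X : Type*} [MetricSpace X] {δ : ℝ} (hδ : 0 ≤ δ)
    (hX : GeodesicSpace X) (hs : SlimTriangles δ X) {f : ℝ → X} {x y p z : X}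
    (hf : IsGeodesicSegment f x y) (hp : p ∈ geodImage f x y)
    (hz : ∀ q ∈ geodImage f x y, dist z p ≤ dist z q) :
    dist z p + dist p x ≤ dist z x + (4 * δ + 5) ∧
      dist z p + dist p y ≤ dist z y + (4 * δ + 5) := by
  have hxy := dist_add_dist_of_mem_geodImage hf hp
  obtain ⟨h0, h1, hd⟩ := hf
  obtain ⟨s, hsI, rfl⟩ := hp
  have hxs : dist (f s) x = s := by
    have := hd s hsI 0 ⟨le_rfl, dist_nonneg⟩
    rwa [h0, sub_zero, abs_of_nonneg hsI.1] at this
  rw [dist_comm x (f s), hxs] at hxy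
  constructor
  · have hmem : ∀ t ∈ Set.Icc 0 (dist (f s) x), s - t ∈ Set.Icc 0 (dist x y) := by
      rintro t ⟨ht0, ht1⟩
      exact ⟨by linarith, by linarith [hsI.2]⟩
    refine dist_add_dist_le_of_nearest_endpoint (f := fun t => f (s - t)) hδ hX hs
      ⟨by simp, by simp [hxs, h0], fun t ht u hu => ?_⟩ ?_
    · rw [hd _ (hmem t ht) _ (hmem u hu), sub_sub_sub_cancel_left, abs_sub_comm]
    · rintro _ ⟨t, ht, rfl⟩
      exact hz _ ⟨_, hmem t ht, rfl⟩
  · have hmem : ∀ t ∈ Set.Icc 0 (dist (f s) y), s + t ∈ Set.Icc 0 (dist x y) := by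
      rintro t ⟨ht0, ht1⟩
      exact ⟨by linarith [hsI.1], by linarith⟩
    refine dist_add_dist_le_of_nearest_endpoint (f := fun t => f (s + t)) hδ hX hs
      ⟨by simp, by simp [hxy, h1], fun t ht u hu => ?_⟩ ?_
    · rw [hd _ (hmem t ht) _ (hmem u hu), add_sub_add_left_eq_sub]
    · rintro _ ⟨t, ht, rfl⟩
      exact hz _ ⟨_, hmem t ht, rfl⟩

/-- shadows and nearest point projections. In a geodesic `δ`-hyperbolic
space with basepoint `x0` there is a constant `C` depending only on `δ` such that: if `z`
lies in the shadow `S_{x0}(y,R)`, `γ` is a geodesic from `x0` to `y` and `p` is a nearest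
point projection of `z` to `γ`, then `d(y,p) ≤ R + C`, while if `z ∉ S_{x0}(y,R)` then
`d(y,p) ≥ R − C`.  Consequently (with a constant `C'` depending only on `δ`) the complement
of `S_x(y,R)` is contained in `S_y(x, d(x,y) − R + C')`. -/
theorem shadow_nearest_point_projection :
    ∀ δ : ℝ, 0 ≤ δ → ∃ C C' : ℝ, 0 ≤ C ∧ 0 ≤ C' ∧
      ∀ (X : Type*) [MetricSpace X], GeodesicSpace X → SlimTriangles δ X →
        (∀ (x0 y z p : X) (R : ℝ) (f : ℝ → X), IsGeodesicSegment f x0 y →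
          p ∈ geodImage f x0 y → Metric.infDist z (geodImage f x0 y) = dist z p →
            (z ∈ shadow x0 y R → dist y p ≤ R + C) ∧
            (z ∉ shadow x0 y R → R - C ≤ dist y p)) ∧
        ∀ (x y : X) (R : ℝ), (shadow x y R)ᶜ ⊆ shadow y x (dist x y - R + C') := by
  intro δ hδ
  refine ⟨(4 * δ + 5) / 2, 0, by positivity, le_rfl, fun X _ hX hs => ⟨?_, ?_⟩⟩
  · intro x0 y z p R f hf hp hinf
    obtain ⟨hx, hy⟩ := dist_add_dist_le_of_nearest_point hδ hX hs hf hp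
      fun q hq => hinf ▸ Metric.infDist_le_dist_of_mem hq
    have hxy := dist_add_dist_of_mem_geodImage hf hp
    have hzx := dist_triangle z p x0
    have hzy := dist_triangle z p y
    simp only [shadow, gromovProd, Set.mem_ofPred_eq, not_le]
    rw [dist_comm x0 z, dist_comm y z, dist_comm y p]
    rw [dist_comm x0 p] at hxy
    constructor <;> intro h <;> linarith
  · intro x y R z hz
    simp only [shadow, gromovProd, Set.mem_compl_iff, Set.mem_ofPred_eq, not_le] at hz ⊢
    rw [dist_comm y x]
    linarith
end

section
/- Let X be a geodesic δ-hyperbolic metric space with basepoint x0. There is a constant C depending only on δ such that for every horofunction h ∈ X̄^h and every pair of points x, y ∈ X, min{ −h(x), −h(y) } ≤ (x·y)_{x0} + C. -/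
open Filter Metric Set Topology

/-- The horofunction `ρ_y(z) = d(z,y) − d(x0,y)` associated to the point `y`, with
basepoint `x0`. -/
def horo {X : Type*} [MetricSpace X] (x0 y : X) : X → ℝ :=
  fun z => dist z y - dist x0 y

/-- The horofunction compactification of `X` (with basepoint `x0`): the closure of the
set of horofunctions `ρ_y`, `y ∈ X`, inside `X → ℝ` with the topology of pointwise
convergence. -/
def horoCpt {X : Type*} [MetricSpace X] (x0 : X) : Set (X → ℝ) :=
  closure (Set.range (horo x0))

theorem IsGeodesicSegment.dist_add_dist {X : Type*} [MetricSpace X] {f : ℝ → X} {x y p : X}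
    (hf : IsGeodesicSegment f x y) (hp : p ∈ geodImage f x y) :
    dist x p + dist p y = dist x y := by
  obtain ⟨t, ht, rfl⟩ := hp
  obtain ⟨h0, h1, h⟩ := hf
  have e0 := h 0 ⟨le_rfl, dist_nonneg⟩ t ht
  have e1 := h t ht (dist x y) ⟨dist_nonneg, le_rfl⟩
  rw [h0, zero_sub, abs_neg, abs_of_nonneg ht.1] at e0
  rw [h1, abs_sub_comm, abs_of_nonneg (sub_nonneg.2 ht.2)] at e1
  linarith

theorem IsGeodesicSegment.left_mem {X : Type*} [MetricSpace X] {f : ℝ → X} {x y : X}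
    (hf : IsGeodesicSegment f x y) : x ∈ geodImage f x y :=
  ⟨0, ⟨le_rfl, dist_nonneg⟩, hf.1⟩

theorem IsGeodesicSegment.right_mem {X : Type*} [MetricSpace X] {f : ℝ → X} {x y : X}
    (hf : IsGeodesicSegment f x y) : y ∈ geodImage f x y :=
  ⟨dist x y, ⟨dist_nonneg, le_rfl⟩, hf.2.1⟩

theorem IsGeodesicSegment.isPreconnected {X : Type*} [MetricSpace X] {f : ℝ → X} {x y : X}
    (hf : IsGeodesicSegment f x y) : IsPreconnected (geodImage f x y) := by
  refine isPreconnected_Icc.image f (LipschitzOnWith.continuousOn (K := 1) ?_)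
  refine LipschitzOnWith.of_dist_le_mul fun s hs t ht => ?_
  rw [hf.2.2 s hs t ht, Real.dist_eq, NNReal.coe_one, one_mul]

theorem SlimTriangles.mem_thickening {X : Type*} [MetricSpace X] {δ r : ℝ}
    (hδ : SlimTriangles δ X) (hr : δ < r) {x y z : X} {f g h : ℝ → X}
    (hf : IsGeodesicSegment f x y) (hg : IsGeodesicSegment g y z)
    (hh : IsGeodesicSegment h x z) {p : X} (hp : p ∈ geodImage f x y) :
    p ∈ thickening r (geodImage g y z) ∪ thickening r (geodImage h x z) := by
  rw [← thickening_union, mem_thickening_iff]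
  exact (infDist_lt_iff ⟨y, Or.inl hg.left_mem⟩).1 ((hδ x y z f g h hf hg hh p hp).trans_lt hr)

/-- In a slim triangle, some point of the side `[x, y]` lies at distance about `(x·y)_z` from
the opposite vertex `z`. -/
theorem SlimTriangles.exists_dist_le_gromovProd {X : Type*} [MetricSpace X] {δ r : ℝ}
    (hδ : SlimTriangles δ X) (hX : GeodesicSpace X) (hr0 : 0 < r) (hr : δ < r) {x y : X} (z : X)
    {f : ℝ → X} (hf : IsGeodesicSegment f x y) :
    ∃ p ∈ geodImage f x y, dist z p ≤ gromovProd z x y + 2 * r := by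
  obtain ⟨g, hg⟩ := hX y z
  obtain ⟨h, hh⟩ := hX x z
  obtain ⟨p, hp, hpg, hph⟩ := hf.isPreconnected _ _ isOpen_thickening isOpen_thickening
    (fun p hp => hδ.mem_thickening hr hf hg hh hp)
    ⟨y, hf.right_mem, self_subset_thickening hr0 _ hg.left_mem⟩
    ⟨x, hf.left_mem, self_subset_thickening hr0 _ hh.left_mem⟩
  obtain ⟨q, hq, hpq⟩ := mem_thickening_iff.1 hpg
  obtain ⟨s, hs, hps⟩ := mem_thickening_iff.1 hph
  refine ⟨p, hp, ?_⟩
  have e1 := hf.dist_add_dist hp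
  have e2 := hg.dist_add_dist hq
  have e3 := hh.dist_add_dist hs
  have t1 := dist_triangle p q z
  have t2 := dist_triangle p s z
  have t3 := dist_triangle x s p
  have t4 := dist_triangle p q y
  rw [dist_comm s p] at t3
  rw [dist_comm q y] at t4
  rw [gromovProd, dist_comm z p, dist_comm z x, dist_comm z y]
  linarith

/-- Distance to a point `z` is quasiconvex along geodesics, up to an error of order `δ`. -/
theorem SlimTriangles.dist_le_max {X : Type*} [MetricSpace X] {δ r : ℝ}
    (hδ : SlimTriangles δ X) (hX : GeodesicSpace X) (hr : δ < r) {x y p : X} (z : X)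
    {f : ℝ → X} (hf : IsGeodesicSegment f x y) (hp : p ∈ geodImage f x y) :
    dist p z ≤ max (dist x z) (dist y z) + r := by
  obtain ⟨g, hg⟩ := hX y z
  obtain ⟨h, hh⟩ := hX x z
  rcases hδ.mem_thickening hr hf hg hh hp with hpt | hpt <;>
    obtain ⟨q, hq, hpq⟩ := mem_thickening_iff.1 hpt
  · linarith [hg.dist_add_dist hq, dist_triangle p q z, le_max_right (dist x z) (dist y z),
      dist_nonneg (x := y) (y := q)]
  · linarith [hh.dist_add_dist hq, dist_triangle p q z, le_max_left (dist x z) (dist y z),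
      dist_nonneg (x := x) (y := q)]

/-- In a geodesic `δ`-hyperbolic space with basepoint `x0`, there is a
constant `C` depending only on `δ` such that for every horofunction `h` in the
horofunction compactification and all `x, y ∈ X`,
`min(−h(x), −h(y)) ≤ (x·y)_{x0} + C`. -/
theorem horofunction_gromov_product_inequality :
    ∀ δ : ℝ, 0 ≤ δ → ∃ C : ℝ, 0 ≤ C ∧
      ∀ (X : Type*) [MetricSpace X], GeodesicSpace X → SlimTriangles δ X →
        ∀ (x0 : X), ∀ h ∈ horoCpt x0, ∀ x y : X,
          min (-h x) (-h y) ≤ gromovProd x0 x y + C := by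
  intro δ hδ0
  refine ⟨3 * (δ + 1), by positivity, fun X _ hX hδ x0 h hh x y => ?_⟩
  have hclosed : IsClosed {h : X → ℝ | min (-h x) (-h y) ≤ gromovProd x0 x y + 3 * (δ + 1)} :=
    isClosed_le (by fun_prop) continuous_const
  refine closure_minimal ?_ hclosed hh
  rintro _ ⟨z, rfl⟩
  obtain ⟨f, hf⟩ := hX x y
  obtain ⟨p, hp, hxp⟩ := hδ.exists_dist_le_gromovProd hX (by linarith) (lt_add_one δ) x0 hf
  have hpz := hδ.dist_le_max hX (lt_add_one δ) z hf hp
  have ht := dist_triangle x0 p z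
  simp only [mem_ofPred_eq, horo, neg_sub]
  rw [min_sub_sub_left]
  linarith
end

section
/- Let X be a geodesic δ-hyperbolic metric space with basepoint x0. There is a constant C depending only on δ such that for each shadow S = S_{x0}(x,R): (1) if z1 and z2 belong to S, then any geodesic segment [z1,z2] lies in S_{x0}(x, R+C); (2) if z1 and z2 do not belong to S, then any geodesic segment [z1,z2] does not intersect S_{x0}(x, R−C). Moreover, for fixed quasigeodesic constants (Q,c), the same statements hold with geodesics replaced by (Q,c)-quasigeodesics, with a constant C depending only on δ, Q and c. -/
open Filter Metric Set Topology

/-- `q` lies on a geodesic between `x` and `y`, expressed through distances. -/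
def MetricBtw {X : Type*} [MetricSpace X] (x q y : X) : Prop :=
  dist x q + dist q y = dist x y

/-- Slimness of triangles, expressed through metric betweenness. -/
def SlimBtw (η : ℝ) (X : Type*) [MetricSpace X] : Prop :=
  ∀ x y z q : X, MetricBtw x q y → ∃ r, dist q r ≤ η ∧ (MetricBtw x r z ∨ MetricBtw y r z)

section Betweenness

variable {X : Type*} [MetricSpace X]

theorem MetricBtw.symm {x q y : X} (h : MetricBtw x q y) : MetricBtw y q x := by
  unfold MetricBtw at *
  rw [dist_comm y q, dist_comm q x, dist_comm y x]
  linarith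

theorem IsGeodesicSegment.dist_left {f : ℝ → X} {x y : X} (h : IsGeodesicSegment f x y)
    {t : ℝ} (ht : t ∈ Set.Icc 0 (dist x y)) : dist x (f t) = t := by
  obtain ⟨h0, -, hd⟩ := h
  have := hd 0 ⟨le_rfl, dist_nonneg⟩ t ht
  rwa [h0, zero_sub, abs_neg, abs_of_nonneg ht.1] at this

theorem IsGeodesicSegment.dist_right {f : ℝ → X} {x y : X} (h : IsGeodesicSegment f x y)
    {t : ℝ} (ht : t ∈ Set.Icc 0 (dist x y)) : dist (f t) y = dist x y - t := by
  obtain ⟨-, h1, hd⟩ := h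
  have := hd t ht (dist x y) ⟨dist_nonneg, le_rfl⟩
  rwa [h1, abs_sub_comm, abs_of_nonneg (sub_nonneg.2 ht.2)] at this

theorem IsGeodesicSegment.metricBtw {f : ℝ → X} {x y : X} (h : IsGeodesicSegment f x y)
    {t : ℝ} (ht : t ∈ Set.Icc 0 (dist x y)) : MetricBtw x (f t) y := by
  unfold MetricBtw
  rw [h.dist_left ht, h.dist_right ht]
  ring

theorem IsGeodesicSegment.metricBtw_of_mem {f : ℝ → X} {x y q : X}
    (h : IsGeodesicSegment f x y) (hq : q ∈ geodImage f x y) : MetricBtw x q y := by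
  obtain ⟨t, ht, rfl⟩ := hq
  exact h.metricBtw ht

theorem GeodesicSpace.exists_segment_through (hX : GeodesicSpace X) {x q y : X}
    (h : MetricBtw x q y) : ∃ f, IsGeodesicSegment f x y ∧ q ∈ geodImage f x y := by
  obtain ⟨g, hg⟩ := hX x q
  obtain ⟨k, hk⟩ := hX q y
  unfold MetricBtw at h
  have hxq : 0 ≤ dist x q := dist_nonneg
  have hqy : 0 ≤ dist q y := dist_nonneg
  let f : ℝ → X := fun t => if t ≤ dist x q then g t else k (t - dist x q)
  have hf1 : ∀ t, t ≤ dist x q → f t = g t := fun t ht => if_pos ht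
  have hf2 : ∀ t, dist x q < t → f t = k (t - dist x q) := fun t ht => if_neg (not_le.2 ht)
  have hle : ∀ s ∈ Set.Icc (0 : ℝ) (dist x y), ∀ t ∈ Set.Icc (0 : ℝ) (dist x y), s ≤ t →
      dist (f s) (f t) = t - s := by
    intro s hs t ht hst
    rcases le_or_gt t (dist x q) with h1 | h1
    · rw [hf1 s (hst.trans h1), hf1 t h1, hg.2.2 s ⟨hs.1, hst.trans h1⟩ t ⟨ht.1, h1⟩,
        abs_sub_comm, abs_of_nonneg (sub_nonneg.2 hst)]
    have ht' : t - dist x q ∈ Set.Icc 0 (dist q y) := ⟨by linarith, by linarith [ht.2]⟩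
    rcases le_or_gt s (dist x q) with h2 | h2
    · rw [hf1 s h2, hf2 t h1]
      have e1 := hg.dist_left (t := s) ⟨hs.1, h2⟩
      have e2 := hg.dist_right (t := s) ⟨hs.1, h2⟩
      have e3 := hk.dist_left ht'
      have e4 := hk.dist_right ht'
      have t1 := dist_triangle (g s) q (k (t - dist x q))
      have t2 := dist_triangle4 x (g s) (k (t - dist x q)) y
      linarith
    · rw [hf2 s h2, hf2 t h1,
        hk.2.2 _ ⟨by linarith, by linarith [hs.2]⟩ _ ht', abs_sub_comm,
        abs_of_nonneg (by linarith)]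
      ring
  have hfq : f (dist x q) = q := by rw [hf1 _ le_rfl, hg.2.1]
  refine ⟨f, ⟨?_, ?_, ?_⟩, dist x q, ⟨hxq, by linarith⟩, hfq⟩
  · rw [hf1 0 hxq, hg.1]
  · rcases hqy.eq_or_lt with h0 | h0
    · have hqy' : q = y := dist_eq_zero.1 h0.symm
      rw [← hqy', hfq]
    · rw [hf2 _ (by linarith), ← h, add_sub_cancel_left, hk.2.1]
  · intro s hs t ht
    rcases le_total s t with hst | hst
    · rw [hle s hs t ht hst, abs_sub_comm, abs_of_nonneg (sub_nonneg.2 hst)]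
    · rw [dist_comm, hle t ht s hs hst, abs_of_nonneg (sub_nonneg.2 hst)]

theorem GeodesicSpace.exists_metricBtw (hX : GeodesicSpace X) (x y : X) {t : ℝ}
    (ht : t ∈ Set.Icc 0 (dist x y)) : ∃ q, MetricBtw x q y ∧ dist x q = t := by
  obtain ⟨f, hf⟩ := hX x y
  exact ⟨f t, hf.metricBtw ht, hf.dist_left ht⟩

theorem SlimTriangles.slimBtw {δ : ℝ} (hX : GeodesicSpace X) (hδ : SlimTriangles δ X) :
    SlimBtw (δ + 1) X := by
  intro x y z q hq
  obtain ⟨f, hf, hqf⟩ := hX.exists_segment_through hq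
  obtain ⟨g, hg⟩ := hX y z
  obtain ⟨h, hh⟩ := hX x z
  have hlt : infDist q (geodImage g y z ∪ geodImage h x z) < δ + 1 :=
    (hδ x y z f g h hf hg hh q hqf).trans_lt (lt_add_one δ)
  have hne : (geodImage g y z ∪ geodImage h x z).Nonempty :=
    ⟨g 0, Or.inl ⟨0, ⟨le_rfl, dist_nonneg⟩, rfl⟩⟩
  obtain ⟨r, hr, hqr⟩ := (infDist_lt_iff hne).1 hlt
  refine ⟨r, hqr.le, ?_⟩
  rcases hr with hr | hr
  · exact Or.inr (hg.metricBtw_of_mem hr)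
  · exact Or.inl (hh.metricBtw_of_mem hr)

end Betweenness

section GromovProduct

variable {X : Type*} [MetricSpace X]

theorem gromovProd_add_swap (x0 x y : X) :
    gromovProd x0 x y + gromovProd x x0 y = dist x0 x := by
  unfold gromovProd
  rw [dist_comm x x0]
  ring

theorem gromovProd_le_add_dist (x0 x p q : X) :
    gromovProd x0 x p ≤ gromovProd x0 x q + dist p q := by
  unfold gromovProd
  have h1 := dist_triangle x0 q p
  have h2 := dist_triangle x p q
  rw [dist_comm q p] at h1
  linarith

theorem MetricBtw.gromovProd_le {x0 x q z : X} (h : MetricBtw z q x0) :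
    gromovProd x0 x q ≤ gromovProd x0 x z := by
  unfold MetricBtw at h
  unfold gromovProd
  have h1 := dist_triangle x q z
  rw [dist_comm x0 q, dist_comm x0 z]
  rw [dist_comm z q] at h
  linarith

theorem SlimBtw.gromovProd_le {η : ℝ} (hη : SlimBtw η X) (x0 x : X) {z1 z2 q : X}
    (h : MetricBtw z1 q z2) :
    gromovProd x0 x q ≤ gromovProd x0 x z1 + η ∨ gromovProd x0 x q ≤ gromovProd x0 x z2 + η := by
  obtain ⟨r, hr, h1 | h1⟩ := hη z1 z2 x0 q h
  · left
    linarith [gromovProd_le_add_dist x0 x q r, h1.gromovProd_le (x := x)]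
  · right
    linarith [gromovProd_le_add_dist x0 x q r, h1.gromovProd_le (x := x)]

/-- Weak convexity of shadows and of their complements, for a point close to a geodesic. -/
theorem SlimBtw.mem_shadow_and_notMem_shadow {η K : ℝ} (hη : SlimBtw η X)
    (x0 x : X) {z1 z2 p q : X} (R : ℝ) (h : MetricBtw z1 q z2) (hpq : dist p q ≤ K) :
    (z1 ∈ shadow x0 x R → z2 ∈ shadow x0 x R → p ∈ shadow x0 x (R + (η + K))) ∧
    (z1 ∉ shadow x0 x R → z2 ∉ shadow x0 x R → p ∉ shadow x0 x (R - (η + K))) := by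
  simp only [shadow, Set.mem_ofPred_eq, not_le]
  constructor
  · intro h1 h2
    have e1 := gromovProd_add_swap x0 x z1
    have e2 := gromovProd_add_swap x0 x z2
    have e3 := gromovProd_add_swap x0 x p
    have e4 := gromovProd_le_add_dist x x0 p q
    rcases hη.gromovProd_le x x0 h with h3 | h3 <;> linarith
  · intro h1 h2
    have e4 := gromovProd_le_add_dist x0 x p q
    rcases hη.gromovProd_le x0 x h with h3 | h3 <;> linarith

end GromovProduct

section Morse

variable {X : Type*} [MetricSpace X]

theorem IsQuasigeodesicOn.abs_sub_le {Q c : ℝ} (hQ : 0 < Q) {f : ℝ → X} {s : Set ℝ}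
    (hf : IsQuasigeodesicOn Q c f s) {u v : ℝ} (hu : u ∈ s) (hv : v ∈ s) :
    |u - v| ≤ Q * (dist (f u) (f v) + c) := by
  have h := (hf u hu v hv).1
  rw [sub_le_iff_le_add, one_div, inv_mul_le_iff₀ hQ] at h
  exact h

/-- A geodesic stays logarithmically close to a quasigeodesic with the same endpoints. -/
theorem SlimBtw.exists_dist_le_of_abs_sub_le_two_pow {η Q c : ℝ} (hη : SlimBtw η X)
    (hQ : 0 < Q) {f : ℝ → X} {s : Set ℝ} (hs : Convex ℝ s) (hf : IsQuasigeodesicOn Q c f s)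
    (k : ℕ) {u v : ℝ} (hu : u ∈ s) (hv : v ∈ s) (huv : |u - v| ≤ 2 ^ k) {q : X}
    (hq : MetricBtw (f u) q (f v)) : ∃ w ∈ s, dist q (f w) ≤ k * η + (Q + c) := by
  induction k generalizing u v q with
  | zero =>
    refine ⟨u, hu, ?_⟩
    have h1 := (hf u hu v hv).2
    have h2 : Q * |u - v| ≤ Q * 1 := by
      gcongr
      simpa using huv
    unfold MetricBtw at hq
    have h3 : 0 ≤ dist q (f v) := dist_nonneg
    rw [dist_comm]
    simp only [Nat.cast_zero]
    linarith
  | succ k ih =>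
    have hm : (u + v) / 2 ∈ s := by
      have := hs hu hv (a := 1 / 2) (b := 1 / 2) (by norm_num) (by norm_num) (by norm_num)
      convert this using 1
      simp only [smul_eq_mul]
      ring
    obtain ⟨r, hr, h⟩ := hη (f u) (f v) (f ((u + v) / 2)) q hq
    rw [pow_succ] at huv
    obtain ⟨w, hw, hrw⟩ : ∃ w ∈ s, dist r (f w) ≤ k * η + (Q + c) := by
      rcases h with h | h
      · refine ih hu hm ?_ h
        rw [show u - (u + v) / 2 = (u - v) / 2 by ring, abs_div, abs_two]
        linarith
      · refine ih hv hm ?_ h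
        rw [show v - (u + v) / 2 = -((u - v) / 2) by ring, abs_neg, abs_div, abs_two]
        linarith
    refine ⟨w, hw, ?_⟩
    have := dist_triangle q r (f w)
    push_cast
    linarith

/-- If all points between `x ∈ F` and `q` are within `M` of `F`, and `q` is almost at distance `M`,
then some `y` between `x` and `q`, at most `2 * M` away from `q`, is joined to a nearby point of `F`
by geodesics that avoid the ball of radius `M - 1` around `q`. -/
theorem GeodesicSpace.exists_detour (hX : GeodesicSpace X) {F : Set X} {x q : X} {M : ℝ}
    (hM : 0 ≤ M) (hxF : x ∈ F) (hq : M - 1 < infDist q F)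
    (hF : ∀ y, MetricBtw x y q → infDist y F ≤ M) :
    ∃ y, ∃ p ∈ F, MetricBtw x y q ∧ dist y q ≤ 2 * M ∧ dist y p ≤ M + 1 ∧
      ∀ r, MetricBtw y r p → M - 1 ≤ dist q r := by
  rcases le_total (2 * M) (dist x q) with h | h
  · obtain ⟨y, hy, hyd⟩ := hX.exists_metricBtw x q (t := dist x q - 2 * M)
      ⟨by linarith, by linarith⟩
    obtain ⟨p, hp, hyp⟩ := (infDist_lt_iff ⟨x, hxF⟩).1 ((hF y hy).trans_lt (lt_add_one M))
    have hy' := hy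
    unfold MetricBtw at hy'
    refine ⟨y, p, hp, hy, by linarith, hyp.le, fun r hr => ?_⟩
    unfold MetricBtw at hr
    have h1 := dist_triangle y r q
    have h2 : 0 ≤ dist r p := dist_nonneg
    rw [dist_comm q r]
    linarith
  · refine ⟨x, x, hxF, by simp [MetricBtw], h, by rw [dist_self]; linarith, fun r hr => ?_⟩
    unfold MetricBtw at hr
    have h1 : 0 ≤ dist r x := dist_nonneg
    rw [dist_self, dist_comm x r] at hr
    have h2 : r = x := dist_eq_zero.1 (by linarith)
    rw [h2]
    exact hq.le.trans (infDist_le_dist_of_mem hxF)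

/-- A quantity bounded by every `k * A + B` with `2 ^ k` at least linear in it is bounded. -/
theorem exists_bound_of_le_of_le_two_pow (A B P T : ℝ) (hA : 0 < A) (hP : 0 ≤ P) :
    ∃ K : ℝ, 0 ≤ K ∧ ∀ M : ℝ, (∀ k : ℕ, P * M + T ≤ 2 ^ k → M ≤ k * A + B) → M ≤ K := by
  have hlin : ∀ᶠ k : ℕ in atTop, P * ((k + 1) * A + B) + T ≤ (2 : ℝ) ^ k := by
    have h1 : Tendsto (fun k : ℕ => (k : ℝ) ^ 1 / (2 : ℝ) ^ k) atTop (𝓝 0) :=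
      tendsto_pow_const_div_const_pow_of_one_lt 1 one_lt_two
    have h2 : Tendsto (fun k : ℕ => (k : ℝ) ^ 0 / (2 : ℝ) ^ k) atTop (𝓝 0) :=
      tendsto_pow_const_div_const_pow_of_one_lt 0 one_lt_two
    have h3 := (h1.const_mul (P * A)).add (h2.const_mul (P * (A + B) + T))
    rw [mul_zero, mul_zero, add_zero] at h3
    filter_upwards [h3.eventually (ge_mem_nhds zero_lt_one)] with k hk
    have h4 : (0 : ℝ) < 2 ^ k := by positivity
    rw [← mul_div_assoc, ← mul_div_assoc, ← add_div, div_le_one h4] at hk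
    refine le_trans (le_of_eq ?_) hk
    ring
  obtain ⟨k0, hk0⟩ := eventually_atTop.1 hlin
  refine ⟨max 0 (k0 * A + B), le_max_left _ _, fun M hM => le_max_of_le_right ?_⟩
  have hstep : ∀ j : ℕ, M ≤ ((k0 + j : ℕ) : ℝ) * A + B → M ≤ k0 * A + B := by
    intro j
    induction j with
    | zero => exact id
    | succ j ih =>
      intro hj
      refine ih (hM _ (le_trans ?_ (hk0 (k0 + j) (Nat.le_add_right _ _))))
      gcongr
      refine hj.trans (le_of_eq ?_)
      push_cast
      ring
  obtain ⟨j, hj⟩ := exists_nat_ge ((M - B) / A)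
  refine hstep j ?_
  rw [div_le_iff₀ hA] at hj
  have : 0 ≤ (k0 : ℝ) * A := by positivity
  push_cast
  linarith

end Morse

/-- Geodesics stay within bounded distance of quasigeodesics with the same endpoints. -/
theorem exists_infDist_quasigeodesic_le (η Q c : ℝ) (hη : 0 < η) (hQ : 0 < Q) (hc : 0 ≤ c) :
    ∃ K : ℝ, 0 ≤ K ∧ ∀ (X : Type*) [MetricSpace X], GeodesicSpace X → SlimBtw η X →
      ∀ (f : ℝ → X) (a b : ℝ), a ≤ b → IsQuasigeodesicOn Q c f (Set.Icc a b) →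
        ∀ q, MetricBtw (f a) q (f b) → infDist q (f '' Set.Icc a b) ≤ K := by
  obtain ⟨K, hK0, hK⟩ := exists_bound_of_le_of_le_two_pow η (2 * η + (Q + c) + 1) (Q * 6)
    (Q * (2 + c)) hη (by positivity)
  refine ⟨K, hK0, fun X _ hX hS f a b hab hf => ?_⟩
  set F : Set X := f '' Set.Icc a b
  have haF : f a ∈ F := ⟨a, ⟨le_rfl, hab⟩, rfl⟩
  have hbF : f b ∈ F := ⟨b, ⟨hab, le_rfl⟩, rfl⟩
  let E : Set ℝ := {e | ∃ q, MetricBtw (f a) q (f b) ∧ infDist q F = e}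
  have hEbdd : BddAbove E := by
    refine ⟨dist (f a) (f b), ?_⟩
    rintro e ⟨q, hq, rfl⟩
    have h1 := infDist_le_dist_of_mem (x := q) haF
    unfold MetricBtw at hq
    have h2 : 0 ≤ dist q (f b) := dist_nonneg
    rw [dist_comm] at h1
    linarith
  have hEne : E.Nonempty := ⟨_, f a, by simp [MetricBtw], rfl⟩
  have hEM : ∀ q, MetricBtw (f a) q (f b) → infDist q F ≤ sSup E := fun q hq =>
    le_csSup hEbdd ⟨q, hq, rfl⟩
  suffices hM : sSup E ≤ K from fun q hq => (hEM q hq).trans hM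
  refine hK _ fun k hk => ?_
  obtain ⟨_, ⟨q, hq, rfl⟩, hqM⟩ := exists_lt_of_lt_csSup hEne (sub_one_lt (sSup E))
  generalize sSup E = M at *
  have hM0 : 0 ≤ M := infDist_nonneg.trans (hEM q hq)
  obtain ⟨y, p, hp, hy, hyq, hyp, hyr⟩ := hX.exists_detour hM0 haF hqM (fun y hy => by
    refine hEM y ?_
    unfold MetricBtw at *
    have h1 := dist_triangle y q (f b)
    have h2 := dist_triangle (f a) y (f b)
    linarith)
  obtain ⟨y', p', hp', hy', hyq', hyp', hyr'⟩ := hX.exists_detour hM0 hbF hqM (fun y hy => by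
    refine hEM y ?_
    have hy := hy.symm
    unfold MetricBtw at *
    have h1 := dist_triangle (f a) q y
    have h2 := dist_triangle (f a) y (f b)
    linarith)
  have hyy' : MetricBtw y q y' := by
    have hy' := hy'.symm
    unfold MetricBtw at *
    have h1 := dist_triangle y q y'
    have h2 := dist_triangle4 (f a) y y' (f b)
    linarith
  obtain ⟨r, hqr, hr | hr⟩ := hS y y' p q hyy'
  · have := hyr r hr
    have : 0 ≤ (k : ℝ) * η := by positivity
    linarith
  obtain ⟨r', hrr', hr' | hr'⟩ := hS y' p p' r hr
  · have := hyr' r' hr'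
    have := dist_triangle q r r'
    have : 0 ≤ (k : ℝ) * η := by positivity
    linarith
  obtain ⟨s, hs, rfl⟩ := hp
  obtain ⟨s', hs', rfl⟩ := hp'
  have hss' : |s - s'| ≤ 2 ^ k := by
    refine (hf.abs_sub_le hQ hs hs').trans (le_trans ?_ hk)
    rw [mul_assoc, ← mul_add]
    refine mul_le_mul_of_nonneg_left ?_ hQ.le
    have h1 := dist_triangle4 (f s) y y' (f s')
    have h2 := dist_triangle y q y'
    rw [dist_comm (f s) y] at h1
    rw [dist_comm q y'] at h2
    linarith
  obtain ⟨w, hw, hrw⟩ :=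
    hS.exists_dist_le_of_abs_sub_le_two_pow hQ (convex_Icc a b) hf k hs hs' hss' hr'
  have h1 := infDist_le_dist_of_mem (x := q) (Set.mem_image_of_mem f hw)
  have h2 := dist_triangle4 q r r' (f w)
  linarith

/-- The Morse lemma: quasigeodesics stay within bounded distance of geodesics. -/
theorem exists_dist_geodesic_le (η Q c : ℝ) (hη : 0 < η) (hQ : 0 < Q) (hc : 0 ≤ c) :
    ∃ K : ℝ, 0 ≤ K ∧ ∀ (X : Type*) [MetricSpace X], GeodesicSpace X → SlimBtw η X →
      ∀ (f : ℝ → X) (a b : ℝ), a ≤ b → IsQuasigeodesicOn Q c f (Set.Icc a b) →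
        ∀ t ∈ Set.Icc a b, ∃ q, MetricBtw (f a) q (f b) ∧ dist (f t) q ≤ K := by
  obtain ⟨D, hD0, hD⟩ := exists_infDist_quasigeodesic_le η Q c hη hQ hc
  refine ⟨Q * (Q * (2 * (D + 1) + c)) + c + (D + 1), by positivity,
    fun X _ hX hS f a b hab hf t ht => ?_⟩
  obtain ⟨g, hg⟩ := hX (f a) (f b)
  have hgcont : ContinuousOn g (Set.Icc 0 (dist (f a) (f b))) := by
    have : LipschitzOnWith 1 g (Set.Icc 0 (dist (f a) (f b))) :=
      LipschitzOnWith.of_dist_le_mul fun u hu v hv => by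
        rw [hg.2.2 u hu v hv, Real.dist_eq, NNReal.coe_one, one_mul]
    exact this.continuousOn
  have hcont : ∀ F : Set X,
      ContinuousOn (fun u => infDist (g u) F) (Set.Icc 0 (dist (f a) (f b))) := fun F =>
    (continuous_infDist_pt F).comp_continuousOn hgcont
  let G : Set X := f '' Set.Icc a t
  let H : Set X := f '' Set.Icc t b
  have hGne : G.Nonempty := ⟨f a, a, ⟨le_rfl, ht.1⟩, rfl⟩
  have hHne : H.Nonempty := ⟨f b, b, ⟨ht.2, le_rfl⟩, rfl⟩
  have hGH : f '' Set.Icc a b = G ∪ H := by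
    rw [← Set.image_union, Set.Icc_union_Icc_eq_Icc ht.1 ht.2]
  have hor : ∀ u ∈ Set.Icc 0 (dist (f a) (f b)),
      infDist (g u) G < D + 1 ∨ infDist (g u) H < D + 1 := by
    intro u hu
    have h := (hD X hX hS f a b hab hf _ (hg.metricBtw hu)).trans_lt (lt_add_one D)
    rw [hGH] at h
    obtain ⟨r, hr | hr, hd⟩ := (infDist_lt_iff (hGne.mono Set.subset_union_left)).1 h
    · exact Or.inl ((infDist_le_dist_of_mem hr).trans_lt hd)
    · exact Or.inr ((infDist_le_dist_of_mem hr).trans_lt hd)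
  obtain ⟨u, hu, huG, huH⟩ : ∃ u ∈ Set.Icc 0 (dist (f a) (f b)),
      infDist (g u) G < D + 1 ∧ infDist (g u) H < D + 1 := by
    by_contra! hcon
    have h0 : (0 : ℝ) ∈ Set.Icc 0 (dist (f a) (f b)) := ⟨le_rfl, dist_nonneg⟩
    have h1 : dist (f a) (f b) ∈ Set.Icc 0 (dist (f a) (f b)) := ⟨dist_nonneg, le_rfl⟩
    have hG0 : infDist (g 0) G = 0 := by
      rw [hg.1]
      exact infDist_zero_of_mem ⟨a, ⟨le_rfl, ht.1⟩, rfl⟩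
    have hH1 : infDist (g (dist (f a) (f b))) H = 0 := by
      rw [hg.2.1]
      exact infDist_zero_of_mem ⟨b, ⟨ht.2, le_rfl⟩, rfl⟩
    have hH0 := hcon 0 h0 (by linarith)
    have hG1 : D + 1 ≤ infDist (g (dist (f a) (f b))) G := by
      by_contra! h
      linarith [hcon _ h1 h]
    obtain ⟨v, hv, hv0⟩ := isPreconnected_Icc.intermediate_value₂ h0 h1 (hcont G) (hcont H)
      (by linarith) (by linarith)
    rcases hor v hv with h | h
    · linarith [hcon v hv h]
    · have := hcon v hv (hv0.trans_lt h)
      linarith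
  obtain ⟨_, ⟨s, hs, rfl⟩, hsd⟩ := (infDist_lt_iff hGne).1 huG
  obtain ⟨_, ⟨s', hs', rfl⟩, hsd'⟩ := (infDist_lt_iff hHne).1 huH
  refine ⟨g u, hg.metricBtw hu, ?_⟩
  have hsI : s ∈ Set.Icc a b := ⟨hs.1, hs.2.trans ht.2⟩
  have hsI' : s' ∈ Set.Icc a b := ⟨ht.1.trans hs'.1, hs'.2⟩
  have h1 : |t - s| ≤ |s' - s| := by
    rw [abs_of_nonneg (sub_nonneg.2 hs.2), abs_of_nonneg (by linarith [hs.2, hs'.1])]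
    linarith [hs'.1]
  have h2 := hf.abs_sub_le hQ hsI' hsI
  have h3 : dist (f s') (f s) ≤ 2 * (D + 1) := by
    have := dist_triangle_left (f s') (f s) (g u)
    linarith
  have h4 : |t - s| ≤ Q * (2 * (D + 1) + c) := by
    refine h1.trans (h2.trans ?_)
    gcongr
  have h5 := (hf t ht s hsI).2
  have h6 : Q * |t - s| ≤ Q * (Q * (2 * (D + 1) + c)) := by gcongr
  have h7 := dist_triangle_right (f t) (g u) (f s)
  linarith

/-- weak convexity of shadows and of their complements. In a geodesic
`δ`-hyperbolic space there is a constant `C`, depending only on `δ`, such that for every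
shadow `S = S_{x0}(x,R)`: (1) if `z1, z2 ∈ S` then any geodesic segment `[z1,z2]` lies in
`S_{x0}(x, R+C)`; (2) if `z1, z2 ∉ S` then any geodesic segment `[z1,z2]` misses
`S_{x0}(x, R−C)`.  Moreover, for fixed quasigeodesic constants `(Q,c)` the same holds for
`(Q,c)`-quasigeodesic segments, with a constant depending only on `δ`, `Q` and `c`. -/
theorem weak_convexity_of_shadows :
    ∀ δ : ℝ, 0 ≤ δ →
      (∃ C : ℝ, 0 ≤ C ∧
        ∀ (X : Type*) [MetricSpace X], GeodesicSpace X → SlimTriangles δ X →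
          ∀ (x0 x z1 z2 : X) (R : ℝ) (f : ℝ → X), IsGeodesicSegment f z1 z2 →
            (z1 ∈ shadow x0 x R → z2 ∈ shadow x0 x R →
              geodImage f z1 z2 ⊆ shadow x0 x (R + C)) ∧
            (z1 ∉ shadow x0 x R → z2 ∉ shadow x0 x R →
              geodImage f z1 z2 ∩ shadow x0 x (R - C) = ∅)) ∧
      ∀ Q c : ℝ, 0 < Q → 0 ≤ c → ∃ C : ℝ, 0 ≤ C ∧
        ∀ (X : Type*) [MetricSpace X], GeodesicSpace X → SlimTriangles δ X →
          ∀ (x0 x z1 z2 : X) (R : ℝ) (f : ℝ → X) (a b : ℝ), a ≤ b →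
            IsQuasigeodesicOn Q c f (Set.Icc a b) → f a = z1 → f b = z2 →
            (z1 ∈ shadow x0 x R → z2 ∈ shadow x0 x R →
              f '' Set.Icc a b ⊆ shadow x0 x (R + C)) ∧
            (z1 ∉ shadow x0 x R → z2 ∉ shadow x0 x R →
              f '' Set.Icc a b ∩ shadow x0 x (R - C) = ∅) := by
  intro δ hδ
  refine ⟨⟨δ + 1 + 0, by positivity, ?_⟩, fun Q c hQ hc => ?_⟩
  · intro X _ hX hS x0 x z1 z2 R f hf
    have key := fun p (hp : p ∈ geodImage f z1 z2) =>
      (hS.slimBtw hX).mem_shadow_and_notMem_shadow x0 x R (hf.metricBtw_of_mem hp)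
        (dist_self p).le
    refine ⟨fun h1 h2 p hp => (key p hp).1 h1 h2, fun h1 h2 => ?_⟩
    exact Set.eq_empty_of_forall_notMem fun p hp => (key p hp.1).2 h1 h2 hp.2
  · obtain ⟨K, hK0, hK⟩ := exists_dist_geodesic_le (δ + 1) Q c (by positivity) hQ hc
    refine ⟨δ + 1 + K, by positivity, ?_⟩
    rintro X _ hX hS x0 x z1 z2 R f a b hab hf rfl rfl
    have key : ∀ p ∈ f '' Set.Icc a b, ∃ q, MetricBtw (f a) q (f b) ∧ dist p q ≤ K := by
      rintro p ⟨t, ht, rfl⟩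
      exact hK X hX (hS.slimBtw hX) f a b hab hf t ht
    have hshadow := fun p (hp : p ∈ f '' Set.Icc a b) =>
      (hS.slimBtw hX).mem_shadow_and_notMem_shadow x0 x R (key p hp).choose_spec.1
        (key p hp).choose_spec.2
    refine ⟨fun h1 h2 p hp => (hshadow p hp).1 h1 h2, fun h1 h2 => ?_⟩
    exact Set.eq_empty_of_forall_notMem fun p hp => (hshadow p hp.1).2 h1 h2 hp.2
end

section
/- There exists a constant C0 > 0, depending only on δ, such that the following holds. Let g be an isometry of a geodesic δ-hyperbolic metric space X with basepoint x0. If d(x0, g x0) ≥ 2 (g x0 · g⁻¹x0)_{x0} + C0, then the translation length of g satisfies |τ(g) − (d(x0, g x0) − 2 (g⁻¹x0 · g x0)_{x0})| ≤ C, where C is a constant depending only on δ. In particular g is a hyperbolic isometry. -/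
open Filter Metric Set Topology

section

variable {X : Type*} [MetricSpace X] {δ : ℝ}

theorem IsGeodesicSegment.dist_add_dist_of_mem {f : ℝ → X} {x y q : X}
    (hf : IsGeodesicSegment f x y) (hq : q ∈ geodImage f x y) :
    dist x q + dist q y = dist x y := by
  obtain ⟨s, hs, rfl⟩ := hq
  obtain ⟨h0, h1, h⟩ := hf
  have e0 := h 0 ⟨le_rfl, dist_nonneg⟩ s hs
  have e1 := h s hs _ ⟨dist_nonneg, le_rfl⟩
  rw [h0, abs_of_nonpos (by linarith [hs.1])] at e0
  rw [h1, abs_of_nonpos (by linarith [hs.2])] at e1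
  linarith

theorem IsGeodesicSegment.left_mem_geodImage {f : ℝ → X} {x y : X}
    (hf : IsGeodesicSegment f x y) : x ∈ geodImage f x y :=
  ⟨0, ⟨le_rfl, dist_nonneg⟩, hf.1⟩

/-- The point of a side `[x, z]` of a slim triangle at distance `(y·z)_x` from `x` lies almost
on geodesics from `y` to `x` and from `y` to `z`. -/
theorem SlimTriangles.dist_add_dist_le (hX : GeodesicSpace X) (hδ : SlimTriangles δ X)
    {f : ℝ → X} {x z : X} (hf : IsGeodesicSegment f x z) (y : X) :
    gromovProd x y z + dist (f (gromovProd x y z)) y ≤ dist x y + 2 * (δ + 1) ∧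
      dist y (f (gromovProd x y z)) + (dist x z - gromovProd x y z) ≤
        dist y z + 2 * (δ + 1) := by
  obtain ⟨g, hg⟩ := hX z y
  obtain ⟨h, hh⟩ := hX x y
  set t := gromovProd x y z with ht
  have ht' : 2 * t = dist x y + dist x z - dist y z := by rw [ht, gromovProd]; ring
  have t0 : 0 ≤ t := by linarith [dist_triangle y x z, dist_comm x y]
  have t1 : t ≤ dist x z := by linarith [dist_triangle x z y, dist_comm y z]
  have hxt : dist x (f t) = t := by
    have := hf.2.2 0 ⟨le_rfl, dist_nonneg⟩ t ⟨t0, t1⟩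
    rwa [hf.1, zero_sub, abs_neg, abs_of_nonneg t0] at this
  have hp : f t ∈ geodImage f x z := ⟨t, ⟨t0, t1⟩, rfl⟩
  have hzt := hf.dist_add_dist_of_mem hp
  have hlt : infDist (f t) (geodImage g z y ∪ geodImage h x y) < δ + 1 :=
    (hδ x z y f g h hf hg hh _ hp).trans_lt (lt_add_one δ)
  obtain ⟨q, hq, hd⟩ := (infDist_lt_iff ⟨z, Or.inl hg.left_mem_geodImage⟩).1 hlt
  rw [dist_comm y (f t)]
  have h1 := dist_triangle (f t) q y
  rcases hq with hq | hq
  · have e := hg.dist_add_dist_of_mem hq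
    have h2 := dist_triangle (f t) q z
    rw [dist_comm q z] at h2
    rw [dist_comm z y] at e
    constructor <;> linarith
  · have e := hh.dist_add_dist_of_mem hq
    have h2 := dist_triangle x q (f t)
    rw [dist_comm q (f t)] at h2
    constructor <;> linarith

/-- Slim triangles imply Gromov's four-point condition. -/
theorem SlimTriangles.four_point (hX : GeodesicSpace X) (hδ : SlimTriangles δ X)
    (x y z w : X) :
    dist x z + dist y w ≤
      max (dist x y + dist z w) (dist y z + dist x w) + 4 * (δ + 1) := by
  obtain ⟨f, hf⟩ := hX x z
  have bounds (y : X) : 0 ≤ gromovProd x y z ∧ gromovProd x y z ≤ dist x z := by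
    unfold gromovProd
    constructor
    · linarith [dist_triangle y x z, dist_comm x y]
    · linarith [dist_triangle x z y, dist_comm y z]
  obtain ⟨hy1, hy2⟩ := hδ.dist_add_dist_le hX hf y
  obtain ⟨hw1, hw2⟩ := hδ.dist_add_dist_le hX hf w
  have hyw := hf.2.2 _ (bounds y) _ (bounds w)
  have tri := dist_triangle4 y (f (gromovProd x y z)) (f (gromovProd x w z)) w
  rw [dist_comm z w]
  rw [dist_comm (f _) y] at hy1
  rw [dist_comm w (f _)] at hw2
  rcases le_total (gromovProd x y z) (gromovProd x w z) with h | h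
  · rw [abs_of_nonpos (by linarith)] at hyw
    linarith [le_max_right (dist x y + dist w z) (dist y z + dist x w)]
  · rw [abs_of_nonneg (by linarith)] at hyw
    linarith [le_max_left (dist x y + dist w z) (dist y z + dist x w)]

end

theorem dist_iterate_add_iterate {X : Type*} [MetricSpace X] (g : X ≃ᵢ X) (x : X) (m n : ℕ) :
    dist (g^[m] x) (g^[m + n] x) = dist x (g^[n] x) := by
  induction m with
  | zero => simp
  | succ m ih =>
    rw [Nat.succ_add, Function.iterate_succ_apply', Function.iterate_succ_apply',
      g.isometry.dist_eq, ih]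

theorem subadditive_dist_iterate {X : Type*} [MetricSpace X] (g : X ≃ᵢ X) (x : X) :
    Subadditive fun n => dist x (g^[n] x) := fun m n => by
  simpa only [dist_iterate_add_iterate] using dist_triangle x (g^[m] x) (g^[m + n] x)

/-- Along an orbit satisfying a four-point condition, if the second increment of the displacement
exceeds the defect, then all later increments are close to it. -/
theorem displacement_increment_bounds {a : ℕ → ℝ} {K : ℝ} (hK : 0 ≤ K)
    (hlow : ∀ n, a 2 + a (n + 1) ≤ max (a 1 + a n) (a 1 + a (n + 2)) + K)
    (hup : ∀ n, a 1 + a (n + 2) ≤ max (a 1 + a n) (a 2 + a (n + 1)) + K)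
    (hL : K < a 2 - a 1) (n : ℕ) :
    a (n + 1) + (a 2 - a 1 - K) ≤ a (n + 2) ∧ a (n + 2) ≤ a (n + 1) + (a 2 - a 1 + K) := by
  have lower : ∀ n, a (n + 1) + (a 2 - a 1 - K) ≤ a (n + 2) := by
    intro n
    induction n with
    | zero => simp only [zero_add]; linarith
    | succ n ih =>
      have h := hlow (n + 1)
      simp only [add_assoc, Nat.reduceAdd] at h ih ⊢
      rcases max_cases (a 1 + a (n + 1)) (a 1 + a (n + 3)) with h' | h' <;> linarith
  refine ⟨lower n, ?_⟩
  cases n with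
  | zero => simp only [zero_add]; linarith
  | succ n =>
    have h := hup (n + 1)
    have l := lower n
    simp only [add_assoc, Nat.reduceAdd] at h l ⊢
    rcases max_cases (a 1 + a (n + 1)) (a 2 + a (n + 2)) with h' | h' <;> linarith

theorem le_of_tendsto_div_of_le_increment {a : ℕ → ℝ} {c τ : ℝ}
    (ha : ∀ n, a (n + 1) + c ≤ a (n + 2))
    (hτ : Tendsto (fun n : ℕ => a n / n) atTop (𝓝 τ)) : c ≤ τ := by
  have h (n : ℕ) : a 1 + n * c ≤ a (n + 1) := by
    induction n with
    | zero => simp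
    | succ n ih => push_cast; linarith [ha n]
  have hlim : Tendsto (fun n : ℕ => (a 1 - c) / n + c) atTop (𝓝 c) := by
    simpa using (tendsto_const_div_atTop_nhds_zero_nat (a 1 - c)).add_const c
  refine le_of_tendsto_of_tendsto hlim hτ ?_
  filter_upwards [eventually_ge_atTop 1] with n hn
  obtain ⟨m, rfl⟩ := Nat.exists_eq_add_of_le' hn
  have hm : (0 : ℝ) < ((m + 1 : ℕ) : ℝ) := by positivity
  rw [div_add' _ _ _ hm.ne', div_le_div_iff_of_pos_right hm]
  push_cast
  linarith [h m]

/-- estimate for translation length. There are constants `C0 > 0` and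
`C ≥ 0`, depending only on `δ`, such that for any isometry `g` of a geodesic
`δ`-hyperbolic space `X` with basepoint `x0`: if
`d(x0, g x0) ≥ 2 (g x0 · g⁻¹ x0)_{x0} + C0`, then the translation length
`τ(g) = lim_n d(x0, gⁿ x0)/n` exists and satisfies
`|τ(g) − (d(x0, g x0) − 2 (g⁻¹ x0 · g x0)_{x0})| ≤ C`; in particular `τ(g) > 0`, so `g`
is a hyperbolic isometry. -/
theorem translation_length_estimate :
    ∀ δ : ℝ, 0 ≤ δ → ∃ C0 : ℝ, 0 < C0 ∧ ∃ C : ℝ, 0 ≤ C ∧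
      ∀ (X : Type*) [MetricSpace X], GeodesicSpace X → SlimTriangles δ X →
        ∀ (g : X ≃ᵢ X) (x0 : X),
          2 * gromovProd x0 (g x0) (g.symm x0) + C0 ≤ dist x0 (g x0) →
          ∃ τ : ℝ,
            Filter.Tendsto (fun n : ℕ => dist x0 ((⇑g)^[n] x0) / n)
              Filter.atTop (nhds τ) ∧
            |τ - (dist x0 (g x0) - 2 * gromovProd x0 (g.symm x0) (g x0))| ≤ C ∧
            0 < τ := by
  intro δ hδ0
  refine ⟨4 * (δ + 1) + 1, by linarith, 4 * (δ + 1), by linarith, ?_⟩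
  intro X _ hX hδ g x hg
  set a : ℕ → ℝ := fun n => dist x (g^[n] x) with ha
  have a2 : dist (g.symm x) (g x) = a 2 := by
    rw [← g.isometry.dist_eq]; simp [ha]
  have a1 : dist x (g x) = a 1 := rfl
  have am1 : dist x (g.symm x) = a 1 := by
    rw [← g.isometry.dist_eq, g.apply_symm_apply, dist_comm, a1]
  have e1 : dist (g x) (g (g x)) = a 1 := g.isometry.dist_eq _ _
  have shift1 (n : ℕ) : dist (g x) (g^[n + 2] x) = a (n + 1) := by
    have := dist_iterate_add_iterate g x 1 (n + 1)
    rwa [show 1 + (n + 1) = n + 2 by ring] at this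
  have shift2 (n : ℕ) : dist (g (g x)) (g^[n + 2] x) = a n := by
    have := dist_iterate_add_iterate g x 2 n
    rwa [add_comm 2 n] at this
  rw [gromovProd, dist_comm (g x), am1, a1, a2] at hg
  rw [gromovProd, am1, a1, a2]
  have increments := displacement_increment_bounds (a := a) (K := 4 * (δ + 1)) (by linarith)
    (fun n => by
      have := hδ.four_point hX x (g x) (g (g x)) (g^[n + 2] x)
      rwa [shift1, shift2, a1, e1] at this)
    (fun n => by
      have := hδ.four_point hX (g x) x (g (g x)) (g^[n + 2] x)
      rwa [shift1, shift2, dist_comm (g x) x, a1, e1] at this)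
    (by linarith)
  have hbdd : BddBelow (range fun n => a n / n) :=
    ⟨0, by rintro _ ⟨n, rfl⟩; exact div_nonneg dist_nonneg n.cast_nonneg⟩
  have hτ := (subadditive_dist_iterate g x).tendsto_lim hbdd
  refine ⟨_, hτ, ?_⟩
  have lower := le_of_tendsto_div_of_le_increment (fun n => (increments n).1) hτ
  have upper := le_of_tendsto_div_of_le_increment (a := fun n => -a n)
    (c := -(a 2 - a 1 + 4 * (δ + 1))) (fun n => by linarith [(increments n).2])
    (by simpa only [neg_div] using hτ.neg)
  exact ⟨abs_le.2 ⟨by linarith, by linarith⟩, by linarith⟩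
end
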